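/- Let Ω be a locally compact Hausdorff space with countable base, 0 < q < 1, σ a nonzero locally finite Radon measure on Ω, f ≥ 0 a Borel measurable function on Ω, and G a quasi-metric kernel on Ω. Then a nontrivial solution u of u = G(u^q dσ) + f, 0 < u < +∞ σ-a.e., exists if and only if Gσ < +∞, Kσ < +∞, f < +∞, and G(f^q dσ) < +∞ hold σ-a.e. in Ω. -/

import Mathlib

open MeasureTheory ENNReal Set

noncomputable section

namespace NPE

variable {Ω : Type*} [TopologicalSpace Ω] [MeasurableSpace Ω]

/-- The potential `Gμ(x) = ∫_Ω G(x,y) dμ(y)`. -/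
def pot (G : Ω → Ω → ℝ≥0∞) (μ : Measure Ω) (x : Ω) : ℝ≥0∞ :=
  ∫⁻ y, G x y ∂μ

/-- The potential `G(f dσ)(x) = ∫_Ω G(x,y) f(y) dσ(y)`. -/
def potF (G : Ω → Ω → ℝ≥0∞) (σ : Measure Ω) (f : Ω → ℝ≥0∞) (x : Ω) : ℝ≥0∞ :=
  ∫⁻ y, G x y * f y ∂σ

/-- A kernel on `Ω` is a lower semicontinuous function `Ω × Ω → [0,∞]`. -/
def IsKernel (G : Ω → Ω → ℝ≥0∞) : Prop :=
  LowerSemicontinuous (fun p : Ω × Ω => G p.1 p.2)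

/-- A quasi-metric kernel with quasi-metric constant `κ ≥ 1/2`: positive, symmetric and
`d := 1/G` satisfies the quasi-triangle inequality. -/
def IsQuasiMetricKernel (G : Ω → Ω → ℝ≥0∞) (κ : ℝ) : Prop :=
  IsKernel G ∧ (1 / 2 : ℝ) ≤ κ ∧ (∀ x y, 0 < G x y) ∧ (∀ x y, G x y = G y x) ∧
    ∀ x y z, (G x y)⁻¹ ≤ ENNReal.ofReal κ * ((G x z)⁻¹ + (G z y)⁻¹)

/-- The closed support of a measure. -/
def msupp (μ : Measure Ω) : Set Ω :=
  {x | ∀ U : Set Ω, IsOpen U → x ∈ U → 0 < μ U}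

/-- The weak maximum principle with constant `b ≥ 1`. -/
def WMP (G : Ω → Ω → ℝ≥0∞) (b : ℝ) : Prop :=
  1 ≤ b ∧ ∀ μ : Measure Ω, IsLocallyFiniteMeasure μ →
    (∀ x ∈ msupp μ, pot G μ x ≤ 1) → ∀ x, pot G μ x ≤ ENNReal.ofReal b

/-- Quasi-symmetry with constant `a ≥ 1`. -/
def QS (G : Ω → Ω → ℝ≥0∞) (a : ℝ) : Prop :=
  1 ≤ a ∧ ∀ x y, (ENNReal.ofReal a)⁻¹ * G y x ≤ G x y ∧ G x y ≤ ENNReal.ofReal a * G y x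

/-- The `L^q` quasi-norm of a nonnegative function with respect to `σ`. -/
def lqNorm (q : ℝ) (σ : Measure Ω) (f : Ω → ℝ≥0∞) : ℝ≥0∞ :=
  (∫⁻ x, f x ^ q ∂σ) ^ (1 / q)

/-- The least constant `ϰ` in the `(1,q)` weighted norm inequality
`‖Gν‖_{L^q(σ)} ≤ C ‖ν‖` over all finite Radon measures `ν`. -/
def kappa (G : Ω → Ω → ℝ≥0∞) (q : ℝ) (σ : Measure Ω) : ℝ≥0∞ :=
  sInf {C : ℝ≥0∞ | ∀ ν : Measure Ω, IsFiniteMeasure ν →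
    lqNorm q σ (pot G ν) ≤ C * ν Set.univ}

/-- The ball `B(x,r) = {y : G(x,y) > 1/r}`, i.e. `{y : d(x,y) < r}` with `d = 1/G`. -/
def ball (G : Ω → Ω → ℝ≥0∞) (x : Ω) (r : ℝ) : Set Ω :=
  {y | (G x y)⁻¹ < ENNReal.ofReal r}

/-- The intrinsic nonlinear potential
`Kσ(x) = ∫_0^∞ ϰ(B(x,r))^{q/(1-q)} r⁻² dr`. -/
def kpot (G : Ω → Ω → ℝ≥0∞) (q : ℝ) (σ : Measure Ω) (x : Ω) : ℝ≥0∞ :=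
  ∫⁻ r in Set.Ioi (0 : ℝ),
    kappa G q (σ.restrict (ball G x r)) ^ (q / (1 - q)) / ENNReal.ofReal (r ^ 2)

/-- A nontrivial super-solution of `u = G(u^q dσ) + d`:
`u > 0` σ-a.e. and `G(u^q dσ) + d ≤ u < ∞` σ-a.e. -/
def IsSupSol (G : Ω → Ω → ℝ≥0∞) (σ : Measure Ω) (q : ℝ) (d : Ω → ℝ≥0∞)
    (u : Ω → ℝ≥0∞) : Prop :=
  Measurable u ∧ (∀ᵐ x ∂σ, 0 < u x) ∧
    ∀ᵐ x ∂σ, potF G σ (fun y => u y ^ q) x + d x ≤ u x ∧ u x < ∞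

/-- A sub-solution: `u ≤ G(u^q dσ) + d < ∞` σ-a.e. -/
def IsSubSol (G : Ω → Ω → ℝ≥0∞) (σ : Measure Ω) (q : ℝ) (d : Ω → ℝ≥0∞)
    (u : Ω → ℝ≥0∞) : Prop :=
  Measurable u ∧
    ∀ᵐ x ∂σ, u x ≤ potF G σ (fun y => u y ^ q) x + d x ∧
      potF G σ (fun y => u y ^ q) x + d x < ∞

/-- A nontrivial solution: `u > 0` σ-a.e. and `u = G(u^q dσ) + d`, `u < ∞`, σ-a.e. -/
def IsSol (G : Ω → Ω → ℝ≥0∞) (σ : Measure Ω) (q : ℝ) (d : Ω → ℝ≥0∞)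
    (u : Ω → ℝ≥0∞) : Prop :=
  Measurable u ∧ (∀ᵐ x ∂σ, 0 < u x) ∧
    ∀ᵐ x ∂σ, u x = potF G σ (fun y => u y ^ q) x + d x ∧ u x < ∞

/-- The growth conditions `∫_a^∞ σ(B(x₀,r)) r⁻² dr < ∞`,
`∫_a^∞ ϰ(B(x₀,r))^{q/(1-q)} r⁻² dr < ∞` and `∫_a^∞ μ(B(x₀,r)) r⁻² dr < ∞`. -/
def growthConds (G : Ω → Ω → ℝ≥0∞) (q : ℝ) (σ μ : Measure Ω) (x₀ : Ω) (a : ℝ) : Prop :=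
  (∫⁻ r in Set.Ioi a, σ (ball G x₀ r) / ENNReal.ofReal (r ^ 2)) < ∞ ∧
  (∫⁻ r in Set.Ioi a,
      kappa G q (σ.restrict (ball G x₀ r)) ^ (q / (1 - q)) / ENNReal.ofReal (r ^ 2)) < ∞ ∧
  (∫⁻ r in Set.Ioi a, μ (ball G x₀ r) / ENNReal.ofReal (r ^ 2)) < ∞

/-- The modified kernel `G̃(x,y) = G(x,y)/(m(x)m(y))`. -/
def modKer (G : Ω → Ω → ℝ≥0∞) (m : Ω → ℝ) : Ω → Ω → ℝ≥0∞ :=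
  fun x y => G x y / (ENNReal.ofReal (m x) * ENNReal.ofReal (m y))

/-- The modified measure `dσ̃ = m^{1+q} dσ`. -/
def modMeas (σ : Measure Ω) (m : Ω → ℝ) (q : ℝ) : Measure Ω :=
  σ.withDensity fun x => ENNReal.ofReal (m x) ^ ((1 : ℝ) + q)

lemma layer (a : ℝ≥0∞) :
    ∫⁻ r in Set.Ioi (0 : ℝ), (if a < ENNReal.ofReal r then 1 else 0) / ENNReal.ofReal (r ^ 2)
      = a⁻¹ := by
  have key : ∀ b : ℝ, 0 < b →
      ∫⁻ r in Set.Ioi (0 : ℝ), (if ENNReal.ofReal b < ENNReal.ofReal r then 1 else 0)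
        / ENNReal.ofReal (r ^ 2) = (ENNReal.ofReal b)⁻¹ := by
    intro b hb
    have h1 : ∫⁻ r in Set.Ioi (0 : ℝ), (if ENNReal.ofReal b < ENNReal.ofReal r then 1 else 0)
        / ENNReal.ofReal (r ^ 2) = ∫⁻ r in Set.Ioi b, ENNReal.ofReal (r ^ (-2 : ℝ)) := by
      rw [← lintegral_indicator measurableSet_Ioi, ← lintegral_indicator measurableSet_Ioi]
      congr 1
      ext r
      by_cases h : b < r
      · have hr : 0 < r := hb.trans h
        have : ENNReal.ofReal b < ENNReal.ofReal r := (ENNReal.ofReal_lt_ofReal_iff hr).2 h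
        simp only [Set.indicator, Set.mem_Ioi, hr, h, this, if_true]
        rw [one_div, ← ENNReal.ofReal_inv_of_pos (by positivity), Real.rpow_neg hr.le]
        norm_num
      · have : ¬ ENNReal.ofReal b < ENNReal.ofReal r := by
          rw [not_lt]; exact ENNReal.ofReal_le_ofReal (not_lt.1 h)
        simp [Set.indicator, h, this]
    rw [h1, ← ofReal_integral_eq_lintegral_ofReal
      (integrableOn_Ioi_rpow_of_lt (by norm_num) hb), integral_Ioi_rpow_of_lt (by norm_num) hb,
      ← ENNReal.ofReal_inv_of_pos hb]
    · congr 1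
      norm_num
      rw [Real.rpow_neg_one]
    · refine (ae_restrict_iff' measurableSet_Ioi).2 (Filter.Eventually.of_forall ?_)
      intro r hr
      exact Real.rpow_nonneg (hb.trans hr).le _
  induction a with
  | top => simp
  | coe a =>
    rcases eq_or_ne a 0 with h | h
    · subst h
      rw [ENNReal.coe_zero, ENNReal.inv_zero]
      refine ENNReal.eq_top_of_forall_nnreal_le fun c => ?_
      have hc : (0 : ℝ) < ((c : ℝ) + 1)⁻¹ := by positivity
      calc (c : ℝ≥0∞) ≤ (ENNReal.ofReal ((c : ℝ) + 1)⁻¹)⁻¹ := by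
            rw [← ENNReal.ofReal_inv_of_pos hc, inv_inv, ← ENNReal.ofReal_coe_nnreal]
            exact ENNReal.ofReal_le_ofReal (by linarith)
        _ = _ := (key _ hc).symm
        _ ≤ _ := by
            refine lintegral_mono fun r => ?_
            dsimp only
            gcongr
            split_ifs with h1 h2 h2
            · exact le_rfl
            · exact absurd (lt_of_le_of_lt zero_le h1) h2
            · simp
            · simp
    · have := key a (by positivity)
      rwa [ENNReal.ofReal_coe_nnreal] at this

section
set_option linter.unusedSectionVars false
variable [SecondCountableTopology Ω] [BorelSpace Ω]
  {G : Ω → Ω → ℝ≥0∞} {κ : ℝ}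

lemma measG (hG : IsQuasiMetricKernel G κ) : Measurable (fun p : Ω × Ω => G p.1 p.2) :=
  hG.1.measurable

lemma measGx (hG : IsQuasiMetricKernel G κ) (x : Ω) : Measurable (G x) :=
  (measG hG).comp measurable_prodMk_left

lemma measPot (hG : IsQuasiMetricKernel G κ) (ν : Measure Ω) [SFinite ν] :
    Measurable (pot G ν) := (measG hG).lintegral_prod_right'

lemma openBall (hG : IsQuasiMetricKernel G κ) (x : Ω) (r : ℝ) : IsOpen (ball G x r) := by
  have : LowerSemicontinuous (G x) := hG.1.comp (by fun_prop : Continuous fun y => (x, y))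
  have h := this.isOpen_preimage (ENNReal.ofReal r)⁻¹
  convert h using 1
  ext y
  simp only [ball, Set.mem_ofPred_eq, Set.mem_preimage, Set.mem_Ioi]
  exact ENNReal.inv_lt_iff_inv_lt

lemma measBall (hG : IsQuasiMetricKernel G κ) (x : Ω) (r : ℝ) : MeasurableSet (ball G x r) :=
  (openBall hG x r).measurableSet

lemma pot_layer (hG : IsQuasiMetricKernel G κ) (ν : Measure Ω) [SFinite ν] (x : Ω) (c : ℝ)
    (hc : 0 < c) :
    ∫⁻ r in Set.Ioi (0 : ℝ), ν (ball G x (c * r)) / ENNReal.ofReal (r ^ 2)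
      = ENNReal.ofReal c * pot G ν x := by
  have hc0 : ENNReal.ofReal c ≠ 0 := by simpa using hc
  have h1 : ∀ r : ℝ, ν (ball G x (c * r)) / ENNReal.ofReal (r ^ 2) =
      ∫⁻ y, (if (G x y)⁻¹ / ENNReal.ofReal c < ENNReal.ofReal r then 1 else 0)
        / ENNReal.ofReal (r ^ 2) ∂ν := by
    intro r
    have hm : MeasurableSet {y | (G x y)⁻¹ / ENNReal.ofReal c < ENNReal.ofReal r} :=
      measurableSet_lt (((measGx hG x).inv).div_const _) measurable_const
    have : ball G x (c * r) = {y | (G x y)⁻¹ / ENNReal.ofReal c < ENNReal.ofReal r} := by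
      ext y
      simp only [ball, Set.mem_ofPred_eq]
      rw [ENNReal.ofReal_mul hc.le, ENNReal.div_lt_iff (Or.inl hc0) (Or.inl ENNReal.ofReal_ne_top),
        mul_comm]
    simp only [div_eq_mul_inv] at *
    rw [lintegral_mul_const]
    · rw [this, ← lintegral_indicator_one hm]
      congr 2
      ext y
      simp [Set.indicator]
    · exact Measurable.ite hm measurable_const measurable_const
  simp_rw [h1]
  rw [lintegral_lintegral_swap]
  · simp_rw [layer]
    rw [pot, ← lintegral_const_mul _ (measGx hG x)]
    congr 1
    ext y
    rw [ENNReal.inv_div (Or.inl ENNReal.ofReal_ne_top) (Or.inl hc0), div_eq_mul_inv, inv_inv]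
  · refine Measurable.aemeasurable ?_
    refine Measurable.div (Measurable.ite (measurableSet_lt ?_ ?_) measurable_const measurable_const) ?_
    · exact ((((measGx hG x).comp measurable_snd).inv).div_const _)
    · fun_prop
    · fun_prop

lemma potF_eq (hG : IsQuasiMetricKernel G κ) (σ : Measure Ω) {F : Ω → ℝ≥0∞} (hF : Measurable F)
    (x : Ω) : potF G σ F x = pot G (σ.withDensity F) x := by
  rw [pot, lintegral_withDensity_eq_lintegral_mul _ hF (measGx hG x), potF]
  simp [mul_comm]

/-- Vitali type weak estimate. -/
lemma weak (hG : IsQuasiMetricKernel G κ) (ν ω : Measure Ω) [IsFiniteMeasure ν] [SFinite ω]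
    (t : ℝ≥0∞) (ht : t ≠ 0) (ht' : t ≠ ∞) :
    ω {x | t * pot G ω x < pot G ν x} ≤ ENNReal.ofReal (3 * κ) / t * ν Set.univ := by
  obtain ⟨-, hκ, hpos, hsymm, htri⟩ := id hG
  have hκ0 : 0 < κ := by linarith
  set A := 3 * κ with hA
  have hA0 : 0 < A := by positivity
  have hAe : ENNReal.ofReal A ≠ 0 := by simpa using hA0
  let P : Ω → ℝ → Prop := fun x r => 0 < r ∧
    t / ENNReal.ofReal A * ω (ball G x (A * r)) < ν (ball G x r)
  let E : ℕ → Set Ω := fun n => {x | ∃ r, P x r ∧ r ≤ n}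
  have hsub : {x | t * pot G ω x < pot G ν x} ⊆ ⋃ n, E n := by
    intro x hx
    by_contra hcon
    have h2 : ∀ r : ℝ, 0 < r → ν (ball G x r) ≤ t / ENNReal.ofReal A * ω (ball G x (A * r)) := by
      intro r hr
      by_contra h
      obtain ⟨n, hn⟩ := exists_nat_ge r
      exact hcon (Set.mem_iUnion.2 ⟨n, r, ⟨hr, not_le.1 h⟩, hn⟩)
    have h3 : pot G ν x ≤ t * pot G ω x := by
      have e1 := pot_layer hG ν x 1 one_pos
      simp only [one_mul, ENNReal.ofReal_one] at e1
      rw [← e1]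
      calc _ ≤ ∫⁻ r in Set.Ioi (0 : ℝ), t / ENNReal.ofReal A *
              (ω (ball G x (A * r)) / ENNReal.ofReal (r ^ 2)) := by
            refine setLIntegral_mono' measurableSet_Ioi fun r hr => ?_
            rw [← mul_div_assoc]
            gcongr
            exact h2 r hr
        _ = t / ENNReal.ofReal A * (ENNReal.ofReal A * pot G ω x) := by
            rw [lintegral_const_mul' _ _ (ENNReal.div_ne_top ht' hAe), pot_layer hG ω x A hA0]
        _ = _ := by
            rw [← mul_assoc, ENNReal.div_mul_cancel hAe ENNReal.ofReal_ne_top]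
    exact absurd hx (not_lt.2 h3)
  have hmono : Monotone E := by
    intro m n hmn x ⟨r, hr, hrm⟩
    exact ⟨r, hr, hrm.trans (by exact_mod_cast hmn)⟩
  refine (measure_mono hsub).trans ?_
  rw [hmono.measure_iUnion]
  refine iSup_le fun n => ?_
  have hex : ∀ x, ∃ r, x ∈ E n → P x r ∧ r ≤ n := by
    intro x
    by_cases h : x ∈ E n
    · obtain ⟨r, hr⟩ := h
      exact ⟨r, fun _ => hr⟩
    · exact ⟨0, fun h' => absurd h' h⟩
  choose r hr using hex
  have hne : ∀ a ∈ E n, (ball G a (r a)).Nonempty := by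
    intro a ha
    by_contra h
    rw [Set.not_nonempty_iff_eq_empty] at h
    have := (hr a ha).1.2
    rw [h] at this
    simp at this
  obtain ⟨u, hu, hdisj, hcov⟩ := Vitali.exists_disjoint_subfamily_covering_enlargement
    (fun a => ball G a (r a)) (E n) r 2 (by norm_num) (fun a ha => (hr a ha).1.1.le) n
    (fun a ha => (hr a ha).2) hne
  have hcount : u.Countable := hdisj.countable_of_isOpen (fun a _ => openBall hG a (r a))
    (fun a ha => hne a (hu ha))
  have hcover : E n ⊆ ⋃ b ∈ u, ball G b (A * r b) := by
    intro a ha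
    obtain ⟨b, hb, ⟨z, hza, hzb⟩, hab⟩ := hcov a ha
    have hrb : 0 < r b := (hr b (hu hb)).1.1
    refine Set.mem_iUnion₂.2 ⟨b, hb, ?_⟩
    simp only [ball, Set.mem_ofPred_eq] at hza hzb ⊢
    calc (G b a)⁻¹ ≤ ENNReal.ofReal κ * ((G b z)⁻¹ + (G z a)⁻¹) := htri b a z
      _ < ENNReal.ofReal κ * (ENNReal.ofReal (r b) + ENNReal.ofReal (r a)) := by
          rw [hsymm z a]
          exact ENNReal.mul_lt_mul_right (by simpa using hκ0) ENNReal.ofReal_ne_top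
            (ENNReal.add_lt_add hzb hza)
      _ ≤ ENNReal.ofReal κ * (ENNReal.ofReal (r b) + ENNReal.ofReal (2 * r b)) := by
          gcongr
      _ = ENNReal.ofReal (A * r b) := by
          rw [← ENNReal.ofReal_add hrb.le (by positivity), ← ENNReal.ofReal_mul hκ0.le]
          congr 1; rw [hA]; ring
  have hcu : Countable u := hcount.to_subtype
  calc ω (E n) ≤ ω (⋃ b ∈ u, ball G b (A * r b)) := measure_mono hcover
    _ ≤ ∑' b : u, ω (ball G (b : Ω) (A * r b)) := measure_biUnion_le ω hcount _
    _ ≤ ∑' b : u, ENNReal.ofReal A / t * ν (ball G (b : Ω) (r b)) := by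
        refine ENNReal.tsum_le_tsum fun b => ?_
        have := (hr b (hu b.2)).1.2.le
        calc _ = ENNReal.ofReal A / t * (t / ENNReal.ofReal A * ω (ball G (b : Ω) (A * r b))) := by
              rw [← mul_assoc, div_eq_mul_inv, div_eq_mul_inv, mul_assoc (ENNReal.ofReal A),
                ← mul_assoc t⁻¹, ENNReal.inv_mul_cancel ht ht', one_mul,
                ENNReal.mul_inv_cancel hAe ENNReal.ofReal_ne_top, one_mul]
          _ ≤ _ := by gcongr
    _ = ENNReal.ofReal A / t * ν (⋃ b ∈ u, ball G b (r b)) := by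
        rw [ENNReal.tsum_mul_left, measure_biUnion hcount hdisj (fun b _ => measBall hG b (r b))]
    _ ≤ _ := by gcongr; exact Set.subset_univ _

/-- The constant in Kolmogorov's inequality. -/
def kc (q : ℝ) : ℝ≥0∞ := (2 : ℝ≥0∞) ^ q * (1 - (2 : ℝ≥0∞) ^ (q - 1))⁻¹

lemma kc_ne_top {q : ℝ} (hq1 : q < 1) : kc q ≠ ∞ := by
  refine ENNReal.mul_ne_top (ENNReal.rpow_ne_top_of_ne_zero (by norm_num) (by norm_num)) ?_
  rw [Ne, ENNReal.inv_eq_top, tsub_eq_zero_iff_le, not_le]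
  exact ENNReal.rpow_lt_one_of_one_lt_of_neg (by norm_num) (by linarith)

lemma kolm {α : Type*} [MeasurableSpace α] (μ : Measure α) (q : ℝ) (hq0 : 0 < q)
    {h : α → ℝ≥0∞} (hh : Measurable h) (A T : ℝ≥0∞)
    (hA : ∀ t : ℝ≥0∞, t ≠ 0 → t ≠ ∞ → μ {x | t < h x} ≤ A / t)
    (hT : T ≠ 0) (hT' : T ≠ ∞) :
    ∫⁻ x, h x ^ q ∂μ ≤ T ^ q * μ Set.univ + kc q * (T ^ (q - 1) * A) := by
  have hTq : T ^ q ≠ 0 := by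
    simp [ENNReal.rpow_eq_zero_iff, hT, hT']
  have hpt : ∀ x, h x ^ q ≤ T ^ q +
      ∑' k : ℕ, {x | 2 ^ k * T < h x}.indicator (fun _ => (2 ^ (k + 1) * T) ^ q) x := by
    intro x
    rcases le_or_gt (h x) T with hx | hx
    · exact (ENNReal.rpow_le_rpow hx hq0.le).trans le_self_add
    refine le_trans ?_ le_add_self
    rcases eq_or_ne (h x) ∞ with hi | hi
    · have : ∑' k : ℕ, {x | 2 ^ k * T < h x}.indicator (fun _ => (2 ^ (k + 1) * T) ^ q) x = ∞ := by
        rw [eq_top_iff, ← ENNReal.tsum_const_eq_top_of_ne_zero (α := ℕ) hTq]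
        refine ENNReal.tsum_le_tsum fun k => ?_
        have h2 : x ∈ {x | 2 ^ k * T < h x} := by
          change 2 ^ k * T < h x
          rw [hi]
          exact (ENNReal.mul_ne_top (by simp) hT').lt_top
        rw [Set.indicator_of_mem h2]
        refine ENNReal.rpow_le_rpow ?_ hq0.le
        exact le_mul_of_one_le_left' (one_le_pow₀ (by norm_num))
      rw [this]; exact le_top
    · have hex : ∃ k : ℕ, h x ≤ 2 ^ (k + 1) * T := by
        obtain ⟨n, hn⟩ := ENNReal.exists_nat_gt (ENNReal.div_ne_top hi hT)
        refine ⟨n, ?_⟩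
        rw [← ENNReal.div_le_iff hT hT']
        refine hn.le.trans ?_
        have : n ≤ 2 ^ (n + 1) := (Nat.lt_two_pow_self.le).trans (Nat.pow_le_pow_right (by norm_num) (by omega))
        exact_mod_cast this
      classical
      have hk := Nat.find_spec hex
      set k := Nat.find hex with hkdef
      have hk2 : 2 ^ k * T < h x := by
        rcases Nat.eq_zero_or_pos k with h0 | h0
        · rw [h0]; simpa using hx
        · have := Nat.find_min hex (m := k - 1) (by omega)
          rw [not_le] at this
          rwa [Nat.sub_add_cancel h0] at this
      refine le_trans ?_ (ENNReal.le_tsum k)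
      rw [Set.indicator_of_mem (show x ∈ {x | 2 ^ k * T < h x} from hk2)]
      exact ENNReal.rpow_le_rpow hk hq0.le
  have hm : ∀ k : ℕ, MeasurableSet {x | 2 ^ k * T < h x} := fun k =>
    measurableSet_lt measurable_const hh
  calc ∫⁻ x, h x ^ q ∂μ ≤ ∫⁻ x, (T ^ q +
      ∑' k : ℕ, {x | 2 ^ k * T < h x}.indicator (fun _ => (2 ^ (k + 1) * T) ^ q) x) ∂μ :=
        lintegral_mono hpt
    _ = T ^ q * μ Set.univ + ∑' k : ℕ, (2 ^ (k + 1) * T) ^ q * μ {x | 2 ^ k * T < h x} := by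
        rw [lintegral_add_left measurable_const, lintegral_const, lintegral_tsum]
        · congr 2
          ext k
          rw [lintegral_indicator_const (hm k)]
        · intro k
          exact (measurable_const.indicator (hm k)).aemeasurable
    _ ≤ T ^ q * μ Set.univ + ∑' k : ℕ, (2 : ℝ≥0∞) ^ q * (T ^ (q - 1) * A) * ((2 : ℝ≥0∞) ^ (q - 1)) ^ k := by
        refine add_le_add le_rfl (ENNReal.tsum_le_tsum fun k => ?_)
        have h2k : (2 : ℝ≥0∞) ^ k ≠ 0 := by simp
        have h2k' : (2 : ℝ≥0∞) ^ k ≠ ∞ := by simp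
        have h1 := hA (2 ^ k * T) (mul_ne_zero h2k hT) (ENNReal.mul_ne_top h2k' hT')
        have e1 : (2 ^ (k + 1) * T) ^ q = (2 : ℝ≥0∞) ^ q * ((2 : ℝ≥0∞) ^ k * T) ^ q := by
          rw [pow_succ, mul_comm (2 ^ k) 2, mul_assoc, ENNReal.mul_rpow_of_nonneg _ _ hq0.le]
        have e2 : ((2 : ℝ≥0∞) ^ k * T) ^ q * (A / (2 ^ k * T)) = ((2 : ℝ≥0∞) ^ k * T) ^ (q - 1) * A := by
          rw [ENNReal.rpow_sub _ _ (mul_ne_zero h2k hT) (ENNReal.mul_ne_top h2k' hT'),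
            ENNReal.rpow_one, div_eq_mul_inv, div_eq_mul_inv]
          ring
        have e3 : ((2 : ℝ≥0∞) ^ k * T) ^ (q - 1) = ((2 : ℝ≥0∞) ^ (q - 1)) ^ k * T ^ (q - 1) := by
          rw [ENNReal.mul_rpow_of_ne_top h2k' hT']
          congr 1
          rw [← ENNReal.rpow_natCast, ← ENNReal.rpow_natCast, ← ENNReal.rpow_mul, ← ENNReal.rpow_mul,
            mul_comm]
        calc _ ≤ (2 ^ (k + 1) * T) ^ q * (A / (2 ^ k * T)) := by gcongr
          _ = (2 : ℝ≥0∞) ^ q * (T ^ (q - 1) * A) * ((2 : ℝ≥0∞) ^ (q - 1)) ^ k := by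
            rw [e1, mul_assoc, e2, e3]; ring
    _ = _ := by
        rw [ENNReal.tsum_mul_left, ENNReal.tsum_geometric, kc]
        ring

lemma young (X m l : ℝ≥0∞) (q : ℝ) (hq0 : 0 < q) (hq1 : q < 1) (hl : l ≠ 0) (hl' : l ≠ ∞) :
    X ^ (1 - q) * m ^ q ≤ l ^ q * X + l ^ (q - 1) * m := by
  have hx : ∀ Y : ℝ≥0∞, Y ^ (1 - q) * Y ^ q = Y := by
    intro Y
    rw [← ENNReal.rpow_add_of_nonneg _ _ (by linarith) hq0.le]
    simp
  rcases le_total m (l * X) with h | h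
  · refine le_trans ?_ le_self_add
    calc X ^ (1 - q) * m ^ q ≤ X ^ (1 - q) * (l * X) ^ q := by gcongr
      _ = l ^ q * (X ^ (1 - q) * X ^ q) := by
          rw [ENNReal.mul_rpow_of_nonneg _ _ hq0.le]; ring
      _ = _ := by rw [hx]
  · refine le_trans ?_ le_add_self
    have hX : X ≤ l⁻¹ * m := by
      rw [mul_comm, ← div_eq_mul_inv, ENNReal.le_div_iff_mul_le (Or.inl hl) (Or.inl hl'), mul_comm]
      exact h
    calc X ^ (1 - q) * m ^ q ≤ (l⁻¹ * m) ^ (1 - q) * m ^ q := by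
          gcongr
      _ = (l⁻¹) ^ (1 - q) * (m ^ (1 - q) * m ^ q) := by
          rw [ENNReal.mul_rpow_of_nonneg _ _ (by linarith)]; ring
      _ = _ := by
          rw [hx, ENNReal.inv_rpow, ← ENNReal.rpow_neg, neg_sub]

lemma upper_set_lemma {α : Type*} [MeasurableSpace α] (m : Measure α) (g : α → ℝ≥0∞) (s : ℝ≥0∞) :
    m {y | m {z | g y ≤ g z} ≤ s} ≤ s := by
  set S := {y | m {z | g y ≤ g z} ≤ s} with hS
  rcases S.eq_empty_or_nonempty with h | h
  · rw [h]; simp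
  obtain ⟨u, hu, hlim, hmem⟩ := exists_seq_tendsto_sInf (S := g '' S) (h.image g) (OrderBot.bddBelow _)
  choose y hyS hy using hmem
  by_cases hatt : ∃ y ∈ S, g y = sInf (g '' S)
  · obtain ⟨y, hyS, hy⟩ := hatt
    refine le_trans (measure_mono ?_) hyS
    intro z hz
    change g y ≤ g z
    rw [hy]
    exact sInf_le (Set.mem_image_of_mem g hz)
  · have hsub : S ⊆ ⋃ n, {z | u n ≤ g z} := by
      intro z hz
      have h1 : sInf (g '' S) < g z := lt_of_le_of_ne (sInf_le (Set.mem_image_of_mem g hz))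
        (fun h => hatt ⟨z, hz, h.symm⟩)
      obtain ⟨n, hn⟩ := (hlim.eventually_lt_const h1).exists
      exact Set.mem_iUnion.2 ⟨n, hn.le⟩
    refine (measure_mono hsub).trans ?_
    have hmono : Monotone fun n => {z | u n ≤ g z} := by
      intro i j hij z hz
      exact (hu hij).trans hz
    rw [hmono.measure_iUnion]
    refine iSup_le fun n => ?_
    rw [← hy n]
    exact hyS n

lemma kappa_spec (G : Ω → Ω → ℝ≥0∞) {q : ℝ} (hq0 : 0 < q) (σ ν : Measure Ω) [IsFiniteMeasure ν] :
    ∫⁻ x, pot G ν x ^ q ∂σ ≤ (kappa G q σ * ν Set.univ) ^ q := by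
  by_cases h0 : ν = 0
  · subst h0
    simp [pot, hq0]
  have hm : ν Set.univ ≠ 0 := by simpa using h0
  have h1 : lqNorm q σ (pot G ν) ≤ kappa G q σ * ν Set.univ := by
    rw [← ENNReal.div_le_iff hm (measure_ne_top _ _)]
    refine le_sInf fun C hC => ?_
    rw [ENNReal.div_le_iff hm (measure_ne_top _ _)]
    exact hC ν inferInstance
  calc _ = (lqNorm q σ (pot G ν)) ^ q := by
        rw [lqNorm, ← ENNReal.rpow_mul, one_div, inv_mul_cancel₀ hq0.ne', ENNReal.rpow_one]
    _ ≤ _ := ENNReal.rpow_le_rpow h1 hq0.le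

lemma kappa_le (hG : IsQuasiMetricKernel G κ) {q : ℝ} (hq0 : 0 < q) (hq1 : q < 1)
    (σ : Measure Ω) [SigmaFinite σ] {u : Ω → ℝ≥0∞} (hu : Measurable u)
    (hpos : ∀ᵐ x ∂σ, 0 < u x)
    (hsup : ∀ᵐ x ∂σ, potF G σ (fun y => u y ^ q) x ≤ u x ∧ u x < ∞)
    (B : Set Ω) (hB : MeasurableSet B) :
    kappa G q (σ.restrict B) ≤ ((1 + kc q * ENNReal.ofReal (3 * κ)) *
      (σ.withDensity (fun y => u y ^ q) B) ^ (1 - q)) ^ (1 / q) := by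
  have huq : Measurable (fun y => u y ^ q) := hu.pow_const q
  set ω := σ.withDensity (fun y => u y ^ q) with hω
  set c := 1 + kc q * ENNReal.ofReal (3 * κ) with hc
  have hc0 : c ≠ 0 := by simp [hc]
  by_cases hi : ω B = ∞
  · rw [hi, ENNReal.top_rpow_of_pos (by linarith), ENNReal.mul_top hc0,
      ENNReal.top_rpow_of_pos (by positivity)]
    exact le_top
  refine sInf_le ?_
  intro ν hν
  suffices h : ∫⁻ x in B, pot G ν x ^ q ∂σ ≤ c * (ω B) ^ (1 - q) * (ν Set.univ) ^ q by
    rw [lqNorm]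
    calc _ ≤ (c * (ω B) ^ (1 - q) * (ν Set.univ) ^ q) ^ (1 / q) :=
          ENNReal.rpow_le_rpow h (by positivity)
      _ = _ := by
          rw [ENNReal.mul_rpow_of_nonneg _ _ (by positivity : 0 ≤ 1 / q), ← ENNReal.rpow_mul,
            mul_one_div_cancel hq0.ne', ENNReal.rpow_one]
  have hmν := measPot hG ν
  have e1 : ∫⁻ x in B, pot G ν x ^ q ∂σ = ∫⁻ x, (pot G ν x / u x) ^ q ∂(ω.restrict B) := by
    have hd : Measurable (fun x => (pot G ν x / u x) ^ q) := (hmν.div hu).pow_const q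
    rw [hω, restrict_withDensity hB, lintegral_withDensity_eq_lintegral_mul _ huq hd]
    refine lintegral_congr_ae (ae_restrict_of_ae ?_)
    filter_upwards [hpos, hsup] with x hx1 hx2
    simp only [Pi.mul_apply]
    rw [← ENNReal.mul_rpow_of_nonneg _ _ hq0.le, ENNReal.mul_div_cancel hx1.ne' hx2.2.ne]
  by_cases hn : ν Set.univ = 0
  · have : ν = 0 := by simpa using hn
    subst this
    simp [pot, hq0]
  by_cases hM : ω B = 0
  · rw [e1, Measure.restrict_eq_zero.2 hM]
    simp
  rw [e1]
  set n := ν Set.univ with hnd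
  have hn' : n ≠ ∞ := measure_ne_top _ _
  set M := ω B with hMd
  have hk := kolm (ω.restrict B) q hq0 (hmν.div hu) (ENNReal.ofReal (3 * κ) * n) (n / M) ?_
    (ENNReal.div_ne_zero.2 ⟨hn, hi⟩) (ENNReal.div_ne_top hn' hM)
  · refine hk.trans (le_of_eq ?_)
    have hp : ∀ p : ℝ, (n / M) ^ p = n ^ p * M ^ (-p) := by
      intro p
      rw [div_eq_mul_inv, ENNReal.mul_rpow_of_ne_top hn' (by simpa using hM), ENNReal.inv_rpow,
        ENNReal.rpow_neg]
    have h1 : M ^ (-q) * M = M ^ (1 - q) := by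
      nth_rewrite 2 [← ENNReal.rpow_one M]
      rw [← ENNReal.rpow_add _ _ hM hi]
      congr 1; ring
    have h2 : n ^ (q - 1) * n = n ^ q := by
      nth_rewrite 2 [← ENNReal.rpow_one n]
      rw [← ENNReal.rpow_add _ _ hn hn']
      congr 1; ring
    rw [hp, hp, Measure.restrict_apply_univ, ← hMd, neg_sub, hc]
    calc _ = n ^ q * (M ^ (-q) * M) + kc q * ENNReal.ofReal (3 * κ) * ((n ^ (q - 1) * n) * M ^ (1 - q)) := by
          ring
      _ = _ := by rw [h1, h2]; ring
  · intro t ht ht'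
    have hω_ac : ω.restrict B ≪ σ := Measure.restrict_le_self.absolutelyContinuous.trans
      (withDensity_absolutelyContinuous σ _)
    have hae : ∀ᵐ x ∂(ω.restrict B), t < pot G ν x / u x →
        t * pot G (ω.restrict B) x < pot G ν x := by
      refine hω_ac.ae_le ?_
      filter_upwards [hpos, hsup] with x hx1 hx2 h
      rw [ENNReal.lt_div_iff_mul_lt (Or.inl hx1.ne') (Or.inl hx2.2.ne)] at h
      refine lt_of_le_of_lt ?_ h
      gcongr
      refine le_trans ?_ hx2.1
      rw [potF_eq hG σ huq]
      exact lintegral_mono' Measure.restrict_le_self le_rfl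
    calc _ ≤ (ω.restrict B) {x | t * pot G (ω.restrict B) x < pot G ν x} :=
          measure_mono_ae hae
      _ ≤ _ := weak hG ν _ t ht ht'
      _ = _ := by
          rw [div_eq_mul_inv, div_eq_mul_inv]; ring

lemma nec_K (hG : IsQuasiMetricKernel G κ) {q : ℝ} (hq0 : 0 < q) (hq1 : q < 1)
    (σ : Measure Ω) [SigmaFinite σ] {u : Ω → ℝ≥0∞} (hu : Measurable u)
    (hpos : ∀ᵐ x ∂σ, 0 < u x)
    (hsup : ∀ᵐ x ∂σ, potF G σ (fun y => u y ^ q) x ≤ u x ∧ u x < ∞) :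
    ∀ᵐ x ∂σ, kpot G q σ x < ∞ := by
  filter_upwards [hsup] with x hx
  have huq : Measurable (fun y => u y ^ q) := hu.pow_const q
  rw [potF_eq hG σ huq] at hx
  set ω := σ.withDensity (fun y => u y ^ q) with hω
  set c := 1 + kc q * ENNReal.ofReal (3 * κ) with hc
  have hct : c ≠ ∞ := by
    rw [hc]
    exact ENNReal.add_ne_top.2 ⟨by simp, ENNReal.mul_ne_top (kc_ne_top hq1) ENNReal.ofReal_ne_top⟩
  have h1q : 0 < 1 - q := by linarith
  have hct' : c ^ (1 / (1 - q)) ≠ ∞ := ENNReal.rpow_ne_top_of_nonneg (by positivity) hct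
  have hle : kpot G q σ x ≤ c ^ (1 / (1 - q)) * pot G ω x := by
    have e1 := pot_layer hG ω x 1 one_pos
    simp only [one_mul, ENNReal.ofReal_one] at e1
    rw [← e1, kpot, ← lintegral_const_mul' _ _ hct']
    refine lintegral_mono fun r => ?_
    dsimp only
    rw [← mul_div_assoc]
    gcongr
    calc _ ≤ ((c * (ω (ball G x r)) ^ (1 - q)) ^ (1 / q)) ^ (q / (1 - q)) := by
          refine ENNReal.rpow_le_rpow ?_ (by positivity)
          exact kappa_le hG hq0 hq1 σ hu hpos hsup _ (measBall hG x r)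
      _ = _ := by
          rw [← ENNReal.rpow_mul]
          have : 1 / q * (q / (1 - q)) = 1 / (1 - q) := by field_simp
          rw [this, ENNReal.mul_rpow_of_nonneg _ _ (by positivity), ← ENNReal.rpow_mul,
            mul_one_div_cancel h1q.ne', ENNReal.rpow_one]
  exact hle.trans_lt (ENNReal.mul_lt_top hct'.lt_top (hx.1.trans_lt hx.2))

lemma nec_G (hG : IsQuasiMetricKernel G κ) {q : ℝ} (hq0 : 0 < q) (hq1 : q < 1)
    (σ : Measure Ω) [SigmaFinite σ] {u : Ω → ℝ≥0∞} (hu : Measurable u)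
    (hpos : ∀ᵐ x ∂σ, 0 < u x)
    (hsup : ∀ᵐ x ∂σ, potF G σ (fun y => u y ^ q) x ≤ u x ∧ u x < ∞) :
    ∀ᵐ x ∂σ, pot G σ x < ∞ := by
  obtain ⟨-, hκ, hGpos, hsymm, htri⟩ := id hG
  have hκ0 : 0 < κ := by linarith
  filter_upwards [hsup] with x hx
  have huq : Measurable (fun y => u y ^ q) := hu.pow_const q
  simp_rw [potF_eq hG σ huq] at hx hsup
  set ω := σ.withDensity (fun y => u y ^ q) with hω
  have hgx := measGx hG x
  set m := ω.withDensity (G x) with hm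
  have hω_ac : ω ≪ σ := withDensity_absolutelyContinuous σ _
  have hm_ac : m ≪ σ := (withDensity_absolutelyContinuous ω _).trans hω_ac
  have hmass : m Set.univ = pot G ω x := by
    rw [hm, withDensity_apply _ MeasurableSet.univ, Measure.restrict_univ, pot]
  have hmfin : m Set.univ ≠ ∞ := by
    rw [hmass]; exact (hx.1.trans_lt hx.2).ne
  have e1 : pot G σ x = ∫⁻ y, (u y)⁻¹ ^ q ∂m := by
    have hd : Measurable (fun y => (u y)⁻¹ ^ q) := hu.inv.pow_const q
    rw [hm, lintegral_withDensity_eq_lintegral_mul _ hgx hd, hω,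
      lintegral_withDensity_eq_lintegral_mul _ huq (hgx.mul hd), pot]
    refine lintegral_congr_ae ?_
    filter_upwards [hpos, hsup] with y h1 h2
    simp only [Pi.mul_apply]
    rw [mul_left_comm, ← ENNReal.mul_rpow_of_nonneg _ _ hq0.le,
      ENNReal.mul_inv_cancel h1.ne' h2.2.ne]
    simp
  have hlow : ∀ y, m {z | (G x y)⁻¹ ≤ (G x z)⁻¹} ≤ ENNReal.ofReal (2 * κ) * pot G ω y := by
    intro y
    have hms : MeasurableSet {z | (G x y)⁻¹ ≤ (G x z)⁻¹} :=
      measurableSet_le measurable_const hgx.inv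
    rw [hm, withDensity_apply _ hms, pot, ← lintegral_const_mul _ (measGx hG y)]
    refine le_trans (setLIntegral_mono' hms (fun z hz => ?_)) (setLIntegral_le_lintegral _ _)
    have hz' : (G x y)⁻¹ ≤ (G x z)⁻¹ := hz
    have h3 : (G y z)⁻¹ ≤ ENNReal.ofReal (2 * κ) * (G x z)⁻¹ := by
      calc _ ≤ ENNReal.ofReal κ * ((G y x)⁻¹ + (G x z)⁻¹) := htri y z x
        _ ≤ ENNReal.ofReal κ * ((G x z)⁻¹ + (G x z)⁻¹) := by
            rw [hsymm y x]; gcongr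
        _ = _ := by
            rw [ENNReal.ofReal_mul (by norm_num), ← two_mul]
            simp; ring
    have h2κ : ENNReal.ofReal (2 * κ) ≠ 0 := by simpa using hκ0
    have h4 := ENNReal.inv_le_inv.2 h3
    rw [inv_inv, ENNReal.mul_inv (Or.inl h2κ) (Or.inl ENNReal.ofReal_ne_top), inv_inv] at h4
    calc G x z = ENNReal.ofReal (2 * κ) * ((ENNReal.ofReal (2 * κ))⁻¹ * G x z) := by
          rw [← mul_assoc, ENNReal.mul_inv_cancel h2κ ENNReal.ofReal_ne_top, one_mul]
      _ ≤ _ := by gcongr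
  have hk := kolm m q hq0 hu.inv (ENNReal.ofReal (2 * κ)) 1 ?_ one_ne_zero ENNReal.one_ne_top
  · rw [e1]
    refine lt_of_le_of_lt hk ?_
    simp only [ENNReal.one_rpow, one_mul]
    exact ENNReal.add_lt_top.2 ⟨hmfin.lt_top,
      ENNReal.mul_lt_top (kc_ne_top hq1).lt_top ENNReal.ofReal_lt_top⟩
  · intro t ht ht'
    refine le_trans (measure_mono_ae ?_)
      (upper_set_lemma m (fun y => (G x y)⁻¹) (ENNReal.ofReal (2 * κ) / t))
    refine hm_ac.ae_le ?_
    filter_upwards [hsup] with y hy h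
    have h' : t < (u y)⁻¹ := h
    refine (hlow y).trans ?_
    rw [div_eq_mul_inv]
    gcongr
    exact hy.1.trans (ENNReal.lt_inv_iff_lt_inv.1 h').le

lemma meas_layer (μ : Measure Ω) (x : Ω) (c : ℝ) (hc : 0 < c) :
    Measurable (fun r : ℝ => μ (ball G x (c * r)) / ENNReal.ofReal (r ^ 2)) := by
  refine Measurable.div (Monotone.measurable ?_) (by fun_prop)
  intro r s hrs
  refine measure_mono fun y hy => ?_
  exact lt_of_lt_of_le hy (ENNReal.ofReal_le_ofReal (by gcongr))

lemma key_ball (hG : IsQuasiMetricKernel G κ) {q : ℝ} (hq0 : 0 < q) (hq1 : q < 1)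
    (σ μ : Measure Ω) [SFinite μ] (x : Ω) (hx : pot G μ x < ∞)
    (l : ℝ≥0∞) (hl : l ≠ 0) (hl' : l ≠ ∞) (r : ℝ) (hr : 0 < r) :
    ∫⁻ y in ball G x r, pot G μ y ^ q ∂σ ≤
      l ^ q * kappa G q (σ.restrict (ball G x r)) ^ (q / (1 - q)) +
      (l ^ (q - 1) * μ (ball G x (2 * κ * r)) +
        (ENNReal.ofReal (2 * κ) * pot G μ x) ^ q * σ (ball G x r)) := by
  obtain ⟨-, hκ, hGpos, hsymm, htri⟩ := id hG
  have hκ0 : 0 < κ := by linarith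
  have h1q : 0 < 1 - q := by linarith
  set B := ball G x r with hB
  set Bs := ball G x (2 * κ * r) with hBs
  have hmB : MeasurableSet B := measBall hG _ _
  have hmBs : MeasurableSet Bs := measBall hG _ _
  have hR : ENNReal.ofReal (2 * κ * r) ≠ 0 := by simp; positivity
  have hfin : μ Bs < ∞ := by
    have : μ Bs * (ENNReal.ofReal (2 * κ * r))⁻¹ ≤ pot G μ x := by
      calc _ = ∫⁻ y in Bs, (ENNReal.ofReal (2 * κ * r))⁻¹ ∂μ := by
            rw [setLIntegral_const, mul_comm]
        _ ≤ ∫⁻ y in Bs, G x y ∂μ := by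
            refine setLIntegral_mono' hmBs fun y hy => ?_
            have hy' : (G x y)⁻¹ < ENNReal.ofReal (2 * κ * r) := hy
            exact (ENNReal.inv_lt_iff_inv_lt.1 hy').le
        _ ≤ _ := setLIntegral_le_lintegral _ _
    have h2 := this.trans_lt hx
    by_contra h
    rw [not_lt, top_le_iff] at h
    rw [h, ENNReal.top_mul (by simp)] at h2
    exact lt_irrefl _ h2
  have : IsFiniteMeasure (μ.restrict Bs) := ⟨by simpa using hfin⟩
  have hsplit : ∀ y, pot G μ y = pot G (μ.restrict Bs) y + pot G (μ.restrict Bsᶜ) y := by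
    intro y
    exact (lintegral_add_compl _ hmBs).symm
  have hfar : ∀ y ∈ B, pot G (μ.restrict Bsᶜ) y ≤ ENNReal.ofReal (2 * κ) * pot G μ x := by
    intro y hy
    rw [pot, pot, ← lintegral_const_mul _ (measGx hG x)]
    refine le_trans (setLIntegral_mono' hmBs.compl (fun z hz => ?_)) (setLIntegral_le_lintegral _ _)
    have hz' : ENNReal.ofReal (2 * κ * r) ≤ (G x z)⁻¹ := not_lt.1 hz
    have hy' : (G x y)⁻¹ < ENNReal.ofReal r := hy
    have hzt : (G x z)⁻¹ ≠ ∞ := by simpa using (hGpos x z).ne'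
    have h3 : (G x z)⁻¹ ≤ ENNReal.ofReal (2 * κ) * (G y z)⁻¹ := by
      have h4 : (G x z)⁻¹ ≤ ENNReal.ofReal κ * ENNReal.ofReal r + ENNReal.ofReal κ * (G y z)⁻¹ := by
        calc _ ≤ ENNReal.ofReal κ * ((G x y)⁻¹ + (G y z)⁻¹) := htri x z y
          _ ≤ ENNReal.ofReal κ * (ENNReal.ofReal r + (G y z)⁻¹) := by gcongr
          _ = _ := by rw [mul_add]
      have e2 : ENNReal.ofReal (2 * κ * r) = 2 * (ENNReal.ofReal κ * ENNReal.ofReal r) := by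
        rw [mul_assoc, ENNReal.ofReal_mul (by norm_num), ENNReal.ofReal_mul hκ0.le]; simp
      have e3 : ENNReal.ofReal (2 * κ) = 2 * ENNReal.ofReal κ := by
        rw [ENNReal.ofReal_mul (by norm_num)]; simp
      rw [e2] at hz'
      rw [e3]
      have h5 : (G x z)⁻¹ + (G x z)⁻¹ ≤ (G x z)⁻¹ + 2 * ENNReal.ofReal κ * (G y z)⁻¹ := by
        calc _ = 2 * (G x z)⁻¹ := by rw [two_mul]
          _ ≤ 2 * (ENNReal.ofReal κ * ENNReal.ofReal r + ENNReal.ofReal κ * (G y z)⁻¹) := by gcongr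
          _ = 2 * (ENNReal.ofReal κ * ENNReal.ofReal r) + 2 * ENNReal.ofReal κ * (G y z)⁻¹ := by ring
          _ ≤ _ := by gcongr
      exact (ENNReal.add_le_add_iff_left hzt).1 h5
    have h2κ : ENNReal.ofReal (2 * κ) ≠ 0 := by simpa using hκ0
    have h4 := ENNReal.inv_le_inv.2 h3
    rw [inv_inv, ENNReal.mul_inv (Or.inl h2κ) (Or.inl ENNReal.ofReal_ne_top), inv_inv] at h4
    calc G y z = ENNReal.ofReal (2 * κ) * ((ENNReal.ofReal (2 * κ))⁻¹ * G y z) := by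
          rw [← mul_assoc, ENNReal.mul_inv_cancel h2κ ENNReal.ofReal_ne_top, one_mul]
      _ ≤ _ := by gcongr
  have hnear : ∫⁻ y in B, pot G (μ.restrict Bs) y ^ q ∂σ ≤
      l ^ q * kappa G q (σ.restrict B) ^ (q / (1 - q)) + l ^ (q - 1) * μ Bs := by
    refine (kappa_spec G hq0 (σ.restrict B) (μ.restrict Bs)).trans ?_
    have hy := young (kappa G q (σ.restrict B) ^ (q / (1 - q))) (μ Bs) l q hq0 hq1 hl hl'
    rw [← ENNReal.rpow_mul, div_mul_cancel₀ _ h1q.ne'] at hy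
    rwa [ENNReal.mul_rpow_of_nonneg _ _ hq0.le, Measure.restrict_apply_univ]
  calc ∫⁻ y in B, pot G μ y ^ q ∂σ
      ≤ ∫⁻ y in B, (pot G (μ.restrict Bs) y ^ q + (ENNReal.ofReal (2 * κ) * pot G μ x) ^ q) ∂σ := by
        refine setLIntegral_mono' hmB fun y hy => ?_
        rw [hsplit y]
        refine (ENNReal.rpow_add_le_add_rpow _ _ hq0.le hq1.le).trans ?_
        gcongr
        exact hfar y hy
    _ = ∫⁻ y in B, pot G (μ.restrict Bs) y ^ q ∂σ + (ENNReal.ofReal (2 * κ) * pot G μ x) ^ q * σ B := by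
        rw [lintegral_add_right _ measurable_const, setLIntegral_const]
    _ ≤ _ := by
        rw [← add_assoc]
        gcongr

lemma key_est (hG : IsQuasiMetricKernel G κ) {q : ℝ} (hq0 : 0 < q) (hq1 : q < 1)
    (σ μ : Measure Ω) [SFinite σ] [SFinite μ] (x : Ω) (hx : pot G μ x < ∞)
    (l : ℝ≥0∞) (hl : l ≠ 0) (hl' : l ≠ ∞) :
    potF G σ (fun y => pot G μ y ^ q) x ≤
      l ^ (q - 1) * (ENNReal.ofReal (2 * κ) + ENNReal.ofReal (2 * κ) ^ q) * pot G μ x +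
      l ^ q * (kpot G q σ x + ENNReal.ofReal (2 * κ) ^ q * pot G σ x ^ (1 / (1 - q))) := by
  have hκ : 0 < 2 * κ := by have := hG.2.1; linarith
  have h1q : 0 < 1 - q := by linarith
  have hF : Measurable (fun y => pot G μ y ^ q) := (measPot hG μ).pow_const q
  have hlq : l ^ q ≠ ∞ := ENNReal.rpow_ne_top_of_nonneg hq0.le hl'
  have hlq1 : l ^ (q - 1) ≠ ∞ := ENNReal.rpow_ne_top_of_ne_zero hl hl'
  have hcq : (ENNReal.ofReal (2 * κ) * pot G μ x) ^ q ≠ ∞ :=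
    ENNReal.rpow_ne_top_of_nonneg hq0.le (ENNReal.mul_ne_top ENNReal.ofReal_ne_top hx.ne)
  rw [potF_eq hG σ hF]
  have e0 := pot_layer hG (σ.withDensity fun y => pot G μ y ^ q) x 1 one_pos
  have e1 := pot_layer hG σ x 1 one_pos
  have e2 := pot_layer hG μ x (2 * κ) hκ
  have m1 := meas_layer (G := G) σ x 1 one_pos
  have m2 := meas_layer (G := G) μ x (2 * κ) hκ
  simp only [one_mul, ENNReal.ofReal_one] at e0 e1 m1
  rw [← e0]
  have step : ∫⁻ r in Set.Ioi (0 : ℝ), (σ.withDensity fun y => pot G μ y ^ q) (ball G x r) /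
      ENNReal.ofReal (r ^ 2) ≤ l ^ q * kpot G q σ x +
        (l ^ (q - 1) * (ENNReal.ofReal (2 * κ) * pot G μ x) +
          (ENNReal.ofReal (2 * κ) * pot G μ x) ^ q * pot G σ x) := by
    generalize hD : (ENNReal.ofReal (2 * κ) * pot G μ x) ^ q = D at hcq ⊢
    have m3 : Measurable (fun r : ℝ => l ^ (q - 1) * (μ (ball G x (2 * κ * r)) /
        ENNReal.ofReal (r ^ 2)) + D * (σ (ball G x r) / ENNReal.ofReal (r ^ 2))) :=
      (m2.const_mul _).add (m1.const_mul _)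
    rw [← e2, ← e1, kpot, ← lintegral_const_mul' _ _ hlq, ← lintegral_const_mul' _ _ hlq1,
      ← lintegral_const_mul' _ _ hcq, ← lintegral_add_right _ (m1.const_mul _),
      ← lintegral_add_right _ m3]
    refine setLIntegral_mono' measurableSet_Ioi fun r hr => ?_
    rw [withDensity_apply _ (measBall hG x r)]
    simp only [← mul_div_assoc, ← ENNReal.add_div]
    gcongr
    rw [← hD]
    exact key_ball hG hq0 hq1 σ μ x hx l hl hl' r hr
  refine step.trans ?_
  have hy := young (pot G σ x ^ (1 / (1 - q))) (pot G μ x) l q hq0 hq1 hl hl'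
  rw [← ENNReal.rpow_mul, one_div_mul_cancel h1q.ne', ENNReal.rpow_one] at hy
  calc _ = l ^ q * kpot G q σ x + (l ^ (q - 1) * (ENNReal.ofReal (2 * κ) * pot G μ x) +
          ENNReal.ofReal (2 * κ) ^ q * (pot G σ x * pot G μ x ^ q)) := by
        rw [ENNReal.mul_rpow_of_nonneg _ _ hq0.le]; ring
    _ ≤ l ^ q * kpot G q σ x + (l ^ (q - 1) * (ENNReal.ofReal (2 * κ) * pot G μ x) +
          ENNReal.ofReal (2 * κ) ^ q * (l ^ q * pot G σ x ^ (1 / (1 - q)) + l ^ (q - 1) * pot G μ x)) := by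
        gcongr
    _ = _ := by ring

/-- Monotone iterations. -/
def iter (G : Ω → Ω → ℝ≥0∞) (σ : Measure Ω) (q : ℝ) (f w : Ω → ℝ≥0∞) : ℕ → Ω → ℝ≥0∞
  | 0 => w
  | n + 1 => fun x => potF G σ (fun y => iter G σ q f w n y ^ q) x + f x

lemma measPotF (hG : IsQuasiMetricKernel G κ) (σ : Measure Ω) [SFinite σ] {F : Ω → ℝ≥0∞}
    (hF : Measurable F) : Measurable (potF G σ F) := by
  have : potF G σ F = pot G (σ.withDensity F) := funext fun x => potF_eq hG σ hF x
  rw [this]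
  exact measPot hG _

lemma suff (hG : IsQuasiMetricKernel G κ) {q : ℝ} (hq0 : 0 < q) (hq1 : q < 1)
    (σ : Measure Ω) [SigmaFinite σ] (hσ : σ ≠ 0) (f : Ω → ℝ≥0∞) (hf : Measurable f)
    (h : ∀ᵐ x ∂σ, pot G σ x < ∞ ∧ kpot G q σ x < ∞ ∧ f x < ∞ ∧
        potF G σ (fun y => f y ^ q) x < ∞) : ∃ u : Ω → ℝ≥0∞, IsSol G σ q f u := by
  obtain ⟨-, hκ, hGpos, hsymm, htri⟩ := id hG
  have hκ0 : 0 < κ := by linarith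
  have h1q : 0 < 1 - q := by linarith
  -- a ball of positive measure
  have hne : Nonempty Ω := by
    by_contra hne
    rw [not_nonempty_iff] at hne
    exact hσ (Measure.eq_zero_of_isEmpty σ)
  obtain ⟨x0⟩ := hne
  have hball : ∃ n : ℕ, 0 < σ (ball G x0 ((n : ℝ) + 1)) := by
    by_contra hcon
    push Not at hcon
    have hU : (⋃ n : ℕ, ball G x0 ((n : ℝ) + 1)) = Set.univ := by
      rw [Set.eq_univ_iff_forall]
      intro y
      have hy : (G x0 y)⁻¹ ≠ ∞ := by simpa using (hGpos x0 y).ne'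
      obtain ⟨n, hn⟩ := ENNReal.exists_nat_gt hy
      refine Set.mem_iUnion.2 ⟨n, hn.trans_le ?_⟩
      rw [← ENNReal.ofReal_natCast]
      exact ENNReal.ofReal_le_ofReal (by linarith)
    have : σ Set.univ = 0 := by
      rw [← hU, measure_iUnion_null_iff]
      intro n
      exact le_antisymm (hcon n) zero_le
    exact hσ (by simpa using this)
  obtain ⟨N, hN⟩ := hball
  set R : ℝ := (N : ℝ) + 1 with hR
  have hR0 : 0 < R := by positivity
  set E := ball G x0 R with hE
  have hmE : MeasurableSet E := measBall hG _ _
  have h2 : ENNReal.ofReal (2 * κ * R) ≠ 0 := by simp; positivity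
  have hGE : ∀ x ∈ E, ∀ y ∈ E, (ENNReal.ofReal (2 * κ * R))⁻¹ ≤ G x y := by
    intro x hx y hy
    rw [ENNReal.inv_le_iff_inv_le]
    have hx' : (G x0 x)⁻¹ < ENNReal.ofReal R := hx
    have hy' : (G x0 y)⁻¹ < ENNReal.ofReal R := hy
    calc _ ≤ ENNReal.ofReal κ * ((G x x0)⁻¹ + (G x0 y)⁻¹) := htri x y x0
      _ ≤ ENNReal.ofReal κ * (ENNReal.ofReal R + ENNReal.ofReal R) := by
          rw [hsymm x x0]; gcongr
      _ = _ := by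
          rw [← ENNReal.ofReal_add hR0.le hR0.le, ← ENNReal.ofReal_mul hκ0.le]
          congr 1; ring
  obtain ⟨δ, hδ0, hδ⟩ : ∃ δ : ℝ≥0∞, 0 < δ ∧ δ < (ENNReal.ofReal (2 * κ * R))⁻¹ * σ E := by
    refine exists_between ?_
    exact ENNReal.mul_pos (by simp) hN.ne'
  have hδt : δ ≠ ∞ := hδ.ne_top
  set ε := δ ^ (1 / (1 - q)) with hε
  have hε0 : ε ≠ 0 := by
    rw [hε, Ne, ENNReal.rpow_eq_zero_iff]; simp [hδ0.ne', hδt]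
  have hεt : ε ≠ ∞ := ENNReal.rpow_ne_top_of_nonneg (by positivity) hδt
  have hεq0 : ε ^ q ≠ 0 := by
    rw [Ne, ENNReal.rpow_eq_zero_iff]; simp [hε0, hεt]
  have hεqt : ε ^ q ≠ ∞ := ENNReal.rpow_ne_top_of_nonneg hq0.le hεt
  set w : Ω → ℝ≥0∞ := E.indicator (fun _ => ε) with hw
  have hmw : Measurable w := measurable_const.indicator hmE
  set W := iter G σ q f w with hW
  have hWs : ∀ n x, W (n + 1) x = potF G σ (fun y => W n y ^ q) x + f x := fun n x => rfl
  have hW0 : W 0 = w := rfl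
  have hWm : ∀ n, Measurable (W n) := by
    intro n
    induction n with
    | zero => exact hmw
    | succ n ih => exact (measPotF hG σ (ih.pow_const q)).add hf
  have hw1 : ∀ x, w x ≤ potF G σ (fun y => w y ^ q) x := by
    intro x
    by_cases hx : x ∈ E
    · rw [hw, Set.indicator_of_mem hx]
      calc ε = ε ^ q * ε ^ (1 - q) := by
            rw [← ENNReal.rpow_add_of_nonneg _ _ hq0.le h1q.le]; simp
        _ = ε ^ q * δ := by
            rw [hε, ← ENNReal.rpow_mul δ (1 / (1 - q)) (1 - q), one_div_mul_cancel h1q.ne', ENNReal.rpow_one]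
        _ ≤ ε ^ q * ((ENNReal.ofReal (2 * κ * R))⁻¹ * σ E) := by gcongr
        _ = ∫⁻ y in E, (ENNReal.ofReal (2 * κ * R))⁻¹ * ε ^ q ∂σ := by
            rw [setLIntegral_const]; ring
        _ ≤ ∫⁻ y in E, G x y * w y ^ q ∂σ := by
            refine setLIntegral_mono' hmE fun y hy => ?_
            rw [hw, Set.indicator_of_mem hy]
            gcongr
            exact hGE x hx y hy
        _ ≤ _ := setLIntegral_le_lintegral _ _
    · rw [hw, Set.indicator_of_notMem hx]; exact zero_le
  have hmonoF : ∀ (F H : Ω → ℝ≥0∞), (∀ y, F y ≤ H y) → ∀ x,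
      potF G σ (fun y => F y ^ q) x ≤ potF G σ (fun y => H y ^ q) x := by
    intro F H hFH x
    refine lintegral_mono fun y => ?_
    dsimp only
    gcongr
    exact hFH y
  have hWmono : ∀ n x, W n x ≤ W (n + 1) x := by
    intro n
    induction n with
    | zero =>
      intro x
      rw [hWs, hW0]
      exact (hw1 x).trans le_self_add
    | succ n ih =>
      intro x
      rw [hWs, hWs (n + 1)]
      gcongr
      exact hmonoF _ _ ih x
  have hWmono' : Monotone W := monotone_nat_of_le_succ hWmono
  refine ⟨fun x => ⨆ n, W n x, Measurable.iSup hWm, ?_, ?_⟩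
  · refine Filter.Eventually.of_forall fun x => ?_
    refine lt_of_lt_of_le ?_ (le_iSup (fun n => W n x) 1)
    change 0 < W (0 + 1) x
    rw [hWs, hW0]
    refine lt_of_lt_of_le ?_ le_self_add
    rw [pos_iff_ne_zero]
    intro h0
    have hmm : Measurable (fun y => G x y * w y ^ q) := (measGx hG x).mul (hmw.pow_const q)
    rw [potF, lintegral_eq_zero_iff hmm] at h0
    have : σ E = 0 := by
      refine measure_mono_null ?_ h0
      intro y hy h3
      have h4 : G x y * w y ^ q = 0 := h3
      rw [hw, Set.indicator_of_mem hy] at h4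
      exact (mul_ne_zero (hGpos x y).ne' hεq0) h4
    exact hN.ne' this
  · filter_upwards [h] with x hx
    obtain ⟨hx1, hx2, hx3, hx4⟩ := hx
    have hsol : ⨆ n, W n x = potF G σ (fun y => (⨆ n, W n y) ^ q) x + f x := by
      have e1 : potF G σ (fun y => (⨆ n, W n y) ^ q) x = ⨆ n, potF G σ (fun y => W n y ^ q) x := by
        rw [potF]
        have : ∀ y, G x y * (⨆ n, W n y) ^ q = ⨆ n, G x y * W n y ^ q := by
          intro y
          have := (ENNReal.orderIsoRpow q hq0).map_iSup (fun n => W n y)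
          simp only [ENNReal.orderIsoRpow_apply] at this
          rw [this, ENNReal.mul_iSup]
        simp_rw [this]
        rw [lintegral_iSup]
        · rfl
        · intro n
          exact (measGx hG x).mul ((hWm n).pow_const q)
        · intro m n hmn y
          dsimp only
          gcongr
          exact hWmono' hmn y
      rw [e1, ENNReal.iSup_add]
      refine le_antisymm (iSup_le fun n => ?_) (iSup_le fun n => ?_)
      · exact (hWmono n x).trans (le_iSup (fun n => potF G σ (fun y => W n y ^ q) x + f x) n)
      · exact le_iSup (fun n => W n x) (n + 1)
    refine ⟨hsol, ?_⟩
    -- uniform bound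
    set c := ENNReal.ofReal (2 * κ) + ENNReal.ofReal (2 * κ) ^ q with hc
    have hct : c ≠ ∞ := ENNReal.add_ne_top.2 ⟨ENNReal.ofReal_ne_top,
      ENNReal.rpow_ne_top_of_nonneg hq0.le ENNReal.ofReal_ne_top⟩
    have hc0 : c ≠ 0 := by
      rw [hc]
      simp [hκ0]
    set l := (2 * c) ^ (1 / (1 - q)) with hl
    have h2c : 2 * c ≠ 0 := mul_ne_zero (by norm_num) hc0
    have h2ct : 2 * c ≠ ∞ := ENNReal.mul_ne_top (by norm_num) hct
    have hl0 : l ≠ 0 := by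
      rw [hl, Ne, ENNReal.rpow_eq_zero_iff]; simp [hc0, h2ct]
    have hlt : l ≠ ∞ := ENNReal.rpow_ne_top_of_nonneg (by positivity) h2ct
    have hlc : l ^ (q - 1) * c = 2⁻¹ := by
      rw [hl, ← ENNReal.rpow_mul]
      have : 1 / (1 - q) * (q - 1) = -1 := by
        field_simp; ring
      rw [this, ENNReal.rpow_neg_one, ENNReal.mul_inv (Or.inl (by norm_num)) (Or.inl (by norm_num)),
        mul_assoc, ENNReal.inv_mul_cancel hc0 hct, mul_one]
    set Q := l ^ q * (kpot G q σ x + ENNReal.ofReal (2 * κ) ^ q * pot G σ x ^ (1 / (1 - q))) +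
      potF G σ (fun y => f y ^ q) x with hQ
    have hQt : Q < ∞ := by
      refine ENNReal.add_lt_top.2 ⟨ENNReal.mul_lt_top (ENNReal.rpow_ne_top_of_nonneg hq0.le hlt).lt_top
        (ENNReal.add_lt_top.2 ⟨hx2, ENNReal.mul_lt_top ?_ ?_⟩), hx4⟩
      · exact (ENNReal.rpow_ne_top_of_nonneg hq0.le ENNReal.ofReal_ne_top).lt_top
      · exact (ENNReal.rpow_ne_top_of_nonneg (by positivity) hx1.ne).lt_top
    set P : ℕ → ℝ≥0∞ := fun n => potF G σ (fun y => W n y ^ q) x with hP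
    have hP0 : P 0 < ∞ := by
      have : P 0 ≤ ε ^ q * pot G σ x := by
        rw [pot, ← lintegral_const_mul' _ _ hεqt]
        refine lintegral_mono fun y => ?_
        dsimp only
        rw [mul_comm]
        gcongr
        rw [hW0, hw]
        exact Set.indicator_le_self' (fun _ _ => zero_le) y
      exact this.trans_lt (ENNReal.mul_lt_top hεqt.lt_top hx1)
    have hstep : ∀ n, P n < ∞ → P (n + 1) ≤ 2⁻¹ * P n + Q := by
      intro n hn
      have hFm : Measurable (fun y => W n y ^ q) := (hWm n).pow_const q
      set μ := σ.withDensity (fun y => W n y ^ q) with hμ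
      have hPμ : ∀ y, potF G σ (fun y => W n y ^ q) y = pot G μ y := potF_eq hG σ hFm
      have hPn : P n = pot G μ x := hPμ x
      have hk := key_est hG hq0 hq1 σ μ x (by rw [← hPn]; exact hn) l hl0 hlt
      rw [← hc, hlc, ← hPn] at hk
      calc P (n + 1) ≤ potF G σ (fun y => pot G μ y ^ q + f y ^ q) x := by
            refine lintegral_mono fun y => ?_
            dsimp only
            rw [hWs, hPμ]
            gcongr
            exact ENNReal.rpow_add_le_add_rpow _ _ hq0.le hq1.le
        _ = potF G σ (fun y => pot G μ y ^ q) x + potF G σ (fun y => f y ^ q) x := by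
            simp only [potF, mul_add]
            have hmm : Measurable (fun y => G x y * f y ^ q) := (measGx hG x).mul (hf.pow_const q)
            rw [lintegral_add_right _ hmm]
        _ ≤ _ := by
            rw [hQ, ← add_assoc]
            gcongr
    have hbound : ∀ n, P n ≤ P 0 + 2 * Q := by
      intro n
      induction n with
      | zero => exact le_self_add
      | succ n ih =>
        refine (hstep n (ih.trans_lt (ENNReal.add_lt_top.2 ⟨hP0, ENNReal.mul_lt_top (by norm_num) hQt⟩))).trans ?_
        calc 2⁻¹ * P n + Q ≤ 2⁻¹ * (P 0 + 2 * Q) + Q := by gcongr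
          _ = 2⁻¹ * P 0 + 2 * Q := by
              rw [mul_add, ← mul_assoc, ENNReal.inv_mul_cancel (by norm_num) (by norm_num), one_mul,
                add_assoc, two_mul]
          _ ≤ P 0 + 2 * Q := by
              gcongr
              exact mul_le_of_le_one_left' (by norm_num)
    have hall : ⨆ n, W n x ≤ P 0 + 2 * Q + f x := by
      refine iSup_le fun n => (hWmono n x).trans ?_
      rw [hWs]
      gcongr
      exact hbound n
    exact hall.trans_lt (ENNReal.add_lt_top.2
      ⟨ENNReal.add_lt_top.2 ⟨hP0, ENNReal.mul_lt_top (by norm_num) hQt⟩, hx3⟩)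

end

/-- existence criterion for `u = G(u^q dσ) + f` with arbitrary data `f ≥ 0`,
for a quasi-metric kernel. -/
theorem statement8 [LocallyCompactSpace Ω] [T2Space Ω] [SecondCountableTopology Ω]
    [BorelSpace Ω] (G : Ω → Ω → ℝ≥0∞) (κ q : ℝ) (hq0 : 0 < q) (hq1 : q < 1)
    (σ : Measure Ω) [IsLocallyFiniteMeasure σ] (hσ : σ ≠ 0)
    (f : Ω → ℝ≥0∞) (hf : Measurable f)
    (hG : IsQuasiMetricKernel G κ) :
    (∃ u : Ω → ℝ≥0∞, IsSol G σ q f u) ↔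
      ∀ᵐ x ∂σ, pot G σ x < ∞ ∧ kpot G q σ x < ∞ ∧ f x < ∞ ∧
        potF G σ (fun y => f y ^ q) x < ∞ := by
  constructor
  · rintro ⟨u, hu, hpos, hsol⟩
    have hsup : ∀ᵐ x ∂σ, potF G σ (fun y => u y ^ q) x ≤ u x ∧ u x < ∞ := by
      filter_upwards [hsol] with x hx
      exact ⟨le_self_add.trans hx.1.ge, hx.2⟩
    filter_upwards [hsol, nec_G hG hq0 hq1 σ hu hpos hsup, nec_K hG hq0 hq1 σ hu hpos hsup]
      with x hx h1 h2
    refine ⟨h1, h2, (le_add_self.trans hx.1.ge).trans_lt hx.2, ?_⟩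
    refine lt_of_le_of_lt ?_ ((le_self_add.trans hx.1.ge).trans_lt hx.2)
    refine lintegral_mono_ae ?_
    filter_upwards [hsol] with y hy
    gcongr
    exact le_add_self.trans hy.1.ge
  · intro h
    exact suff hG hq0 hq1 σ hσ f hf h

end NPE
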